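/- Let ℓ ∈ ℕ be even and let Λ = (λ(j))_{|j|≤μ} be a finite even real sequence with μ ≥ ℓ/2 - 1. Then for every continuous 1-periodic function f on ℝ: Q_0(f) = Σ_{s∈I(0)} T_{h^{(0)}}^{[P_Λ]}(f)(s h^{(0)}) N_{0,s}, and for every k ≥ 1, Q_k(f) - Q_{k-1}(f) = Σ_{s∈I(k-1)} T_{h^{(k)}}^{[P_even]}(f)(2s h^{(k)}) N_{k,2s} + Σ_{s∈I(k-1)} T_{h^{(k)}}^{[P_odd]}(f)((2s+1) h^{(k)}) N_{k,2s+1}. -/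

import Mathlib

open MeasureTheory Finset
open scoped ENNReal
noncomputable section

/-! Common definitions for Dinh Dũng, "B-spline quasi-interpolation sampling representation
and sampling recovery in Sobolev spaces of mixed smoothness". -/

/-- Cardinal B-spline of order `ℓ`: `M_1 = 1_{[0,1)}`, `M_ℓ = M_{ℓ-1} * M_1` (convolution). -/
noncomputable def bspline : ℕ → ℝ → ℝ
  | 0, _ => 0
  | 1, x => if 0 ≤ x ∧ x < 1 then 1 else 0
  | (n+2), x => ∫ t in (0:ℝ)..1, bspline (n+1) (x - t)

/-- `h^{(k)} = ℓ⁻¹ 2^{-k}`. -/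
noncomputable def hstep (ℓ k : ℕ) : ℝ := ((ℓ : ℝ))⁻¹ * ((2:ℝ) ^ k)⁻¹

/-- The univariate quasi-interpolation coefficient
`a_{k,s}(f) = Σ_{|j|≤μ} λ(j) f(h^{(k)}(s - j + ℓ/2))`. -/
noncomputable def acoef (ℓ μ : ℕ) (lam : ℤ → ℝ) (k : ℕ) (s : ℤ) (f : ℝ → ℝ) : ℝ :=
  ∑ j ∈ Finset.Icc (-(μ:ℤ)) (μ:ℤ), lam j * f (hstep ℓ k * ((s : ℝ) - (j : ℝ) + (ℓ : ℝ)/2))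

/-- The base quasi-interpolation operator `Q(f,x) = Σ_s Λ(f,s) M(x-s)`. -/
noncomputable def Qbase (ℓ μ : ℕ) (lam : ℤ → ℝ) (f : ℝ → ℝ) (x : ℝ) : ℝ :=
  ∑' s : ℤ, (∑ j ∈ Finset.Icc (-(μ:ℤ)) (μ:ℤ), lam j * f ((s:ℝ) - (j:ℝ) + (ℓ:ℝ)/2)) *
    bspline ℓ (x - (s:ℝ))

/-- The scaled operator `Q_k(f,x) = Σ_s a_{k,s}(f) M(ℓ2^k x - s)`. -/
noncomputable def Qk (ℓ μ : ℕ) (lam : ℤ → ℝ) (k : ℕ) (f : ℝ → ℝ) (x : ℝ) : ℝ :=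
  ∑' s : ℤ, acoef ℓ μ lam k s f * bspline ℓ ((ℓ:ℝ) * 2^k * x - (s:ℝ))

/-- The sequence `Λ` is even: `λ(-j) = λ(j)`. -/
def IsEvenSeq (lam : ℤ → ℝ) : Prop := ∀ j : ℤ, lam (-j) = lam j

/-- `Q` is a quasi-interpolation operator: it reproduces all polynomials of degree `≤ ℓ-1`. -/
def IsQuasiInterp (ℓ μ : ℕ) (lam : ℤ → ℝ) : Prop :=
  ∀ g : Polynomial ℝ, g.degree < (ℓ : WithBot ℕ) →
    ∀ x : ℝ, Qbase ℓ μ lam (fun y => Polynomial.eval y g) x = Polynomial.eval x g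

/-- `N_k`: the 1-periodic extension of `M(ℓ2^k ·)`. -/
noncomputable def Nper (ℓ k : ℕ) (x : ℝ) : ℝ := ∑' n : ℤ, bspline ℓ ((ℓ:ℝ) * 2^k * (x - (n:ℝ)))

/-- `N_{k,s}(x) = N_k(x - h^{(k)} s)`. -/
noncomputable def Nks (ℓ k : ℕ) (s : ℤ) (x : ℝ) : ℝ := Nper ℓ k (x - hstep ℓ k * (s:ℝ))

/-- The coefficient of `z^s` in a Laurent polynomial. -/
noncomputable def lcoeff (P : LaurentPolynomial ℝ) (s : ℤ) : ℝ := (P.coeff : ℤ →₀ ℝ) s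

/-- The shift operator `T_h^{[P]}(f)(x) = Σ_s c_s f(x + s h)` generated by a Laurent
polynomial `P(z) = Σ_s c_s z^s`. -/
noncomputable def shiftOp (P : LaurentPolynomial ℝ) (h : ℝ) (f : ℝ → ℝ) (x : ℝ) : ℝ :=
  Finsupp.sum P.coeff fun s c => c * f (x + (s : ℝ) * h)

/-- The `ℓ`-th difference operator `Δ_h^ℓ f(x) = Σ_{j=0}^ℓ (-1)^{ℓ-j} C(ℓ,j) f(x+jh)`. -/
noncomputable def deltaOp (ℓ : ℕ) (h : ℝ) (f : ℝ → ℝ) (x : ℝ) : ℝ :=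
  ∑ j ∈ Finset.range (ℓ+1), (-1:ℝ)^(ℓ - j) * (ℓ.choose j : ℝ) * f (x + (j:ℝ) * h)

/-- The multivariate shift operator `T_𝐡^{[P]}` generated by the tensor-product Laurent
polynomial `P(𝐳) = ∏_j P_j(z_j)`. -/
noncomputable def tensorShift {d : ℕ} (P : Fin d → LaurentPolynomial ℝ) (h : Fin d → ℝ)
    (f : (Fin d → ℝ) → ℝ) (x : Fin d → ℝ) : ℝ :=
  ∑ s ∈ Fintype.piFinset (fun j => (((P j).coeff : ℤ →₀ ℝ)).support),
    (∏ j, lcoeff (P j) (s j)) * f (fun j => x j + (s j : ℝ) * h j)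

/-- `P_Λ(z) = z^{ℓ/2} Σ_{|s|≤μ} λ(s) z^s`. -/
noncomputable def PLam (ℓ μ : ℕ) (lam : ℤ → ℝ) : LaurentPolynomial ℝ :=
  ∑ s ∈ Finset.Icc (-(μ:ℤ)) (μ:ℤ),
    LaurentPolynomial.C (lam s) * LaurentPolynomial.T (s + (ℓ:ℤ)/2)

/-- `P_Λ(z²)`. -/
noncomputable def PLamSq (ℓ μ : ℕ) (lam : ℤ → ℝ) : LaurentPolynomial ℝ :=
  ∑ s ∈ Finset.Icc (-(μ:ℤ)) (μ:ℤ),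
    LaurentPolynomial.C (lam s) * LaurentPolynomial.T (2*(s + (ℓ:ℤ)/2))

/-- `P'_even(z) = 2^{-ℓ+1} P_Λ(z²) Σ_{j=0}^{ℓ/2} C(ℓ,2j) z^{-2j}`. -/
noncomputable def PevenAux (ℓ μ : ℕ) (lam : ℤ → ℝ) : LaurentPolynomial ℝ :=
  LaurentPolynomial.C ((2:ℝ) ^ (1 - (ℓ:ℤ))) * PLamSq ℓ μ lam *
    ∑ j ∈ Finset.range (ℓ/2 + 1),
      LaurentPolynomial.C ((ℓ.choose (2*j) : ℝ)) * LaurentPolynomial.T (-(2*(j:ℤ)))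

/-- `P'_odd(z) = 2^{-ℓ+1} P_Λ(z²) Σ_{j=0}^{ℓ/2-1} C(ℓ,2j+1) z^{-2j-1}`. -/
noncomputable def PoddAux (ℓ μ : ℕ) (lam : ℤ → ℝ) : LaurentPolynomial ℝ :=
  LaurentPolynomial.C ((2:ℝ) ^ (1 - (ℓ:ℤ))) * PLamSq ℓ μ lam *
    ∑ j ∈ Finset.range (ℓ/2),
      LaurentPolynomial.C ((ℓ.choose (2*j+1) : ℝ)) * LaurentPolynomial.T (-(2*(j:ℤ)) - 1)

/-- `P_even = P_Λ - P'_even`. -/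
noncomputable def Peven (ℓ μ : ℕ) (lam : ℤ → ℝ) : LaurentPolynomial ℝ :=
  PLam ℓ μ lam - PevenAux ℓ μ lam

/-- `P_odd = P_Λ - P'_odd`. -/
noncomputable def Podd (ℓ μ : ℕ) (lam : ℤ → ℝ) : LaurentPolynomial ℝ :=
  PLam ℓ μ lam - PoddAux ℓ μ lam

/-- A symmetric Laurent polynomial: its coefficients are symmetric about some
(possibly half-integer) center `c/2`. -/
def IsSymmLaurent (P : LaurentPolynomial ℝ) : Prop :=
  ∃ c : ℤ, ∀ s : ℤ, lcoeff P s = lcoeff P (c - s)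

/-- The unit cube `[0,1]^d`, a model of the torus `𝕋^d`. -/
def cube (d : ℕ) : Set (Fin d → ℝ) := Set.univ.pi fun _ => Set.Icc (0:ℝ) 1

/-- Lebesgue measure restricted to the unit cube. -/
noncomputable def μcube (d : ℕ) : Measure (Fin d → ℝ) := volume.restrict (cube d)

/-- `f` is 1-periodic in each variable, i.e. a function on the torus `𝕋^d`. -/
def PeriodicTd {d : ℕ} (f : (Fin d → ℝ) → ℝ) : Prop :=
  ∀ (x : Fin d → ℝ) (j : Fin d), f (Function.update x j (x j + 1)) = f x

/-- The univariate operator `Q_k` applied in the `j`-th variable. -/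
noncomputable def QkCoord (ℓ μ : ℕ) (lam : ℤ → ℝ) {d : ℕ} (j : Fin d) (k : ℕ)
    (f : (Fin d → ℝ) → ℝ) (x : Fin d → ℝ) : ℝ :=
  ∑' s : ℤ, (∑ i ∈ Finset.Icc (-(μ:ℤ)) (μ:ℤ), lam i *
      f (Function.update x j (hstep ℓ k * ((s:ℝ) - (i:ℝ) + (ℓ:ℝ)/2)))) *
    bspline ℓ ((ℓ:ℝ) * 2^k * x j - (s:ℝ))

/-- `Q_{k} - Q_{k-1}` in the `j`-th variable, with the convention `Q_{-1} = 0`. -/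
noncomputable def qdiffCoord (ℓ μ : ℕ) (lam : ℤ → ℝ) {d : ℕ} (j : Fin d) :
    ℕ → ((Fin d → ℝ) → ℝ) → (Fin d → ℝ) → ℝ
  | 0, f => QkCoord ℓ μ lam j 0 f
  | (k+1), f => fun x => QkCoord ℓ μ lam j (k+1) f x - QkCoord ℓ μ lam j k f x

/-- The mixed operator `Q_𝐤 = ∏_i Q_{k_i}`. -/
noncomputable def Qmix (ℓ μ : ℕ) (lam : ℤ → ℝ) {d : ℕ} (k : Fin d → ℕ)
    (f : (Fin d → ℝ) → ℝ) : (Fin d → ℝ) → ℝ :=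
  (List.finRange d).foldr (fun j g => QkCoord ℓ μ lam j (k j) g) f

/-- The mixed operator `q_𝐤 = ∏_i (Q_{k_i} - Q_{k_i-1})`. -/
noncomputable def qmix (ℓ μ : ℕ) (lam : ℤ → ℝ) {d : ℕ} (k : Fin d → ℕ)
    (f : (Fin d → ℝ) → ℝ) : (Fin d → ℝ) → ℝ :=
  (List.finRange d).foldr (fun j g => qdiffCoord ℓ μ lam j (k j) g) f

/-- The `𝐬`-th Fourier coefficient of a function on `𝕋^d`. -/
noncomputable def fourierCoeffCube (d : ℕ) (f : (Fin d → ℝ) → ℝ) (s : Fin d → ℤ) : ℂ :=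
  ∫ x in cube d, (f x : ℂ) *
    Complex.exp (-(2 * Real.pi * Complex.I) * (∑ j, (s j : ℂ) * (x j : ℂ)))

/-- `Σ_𝐬 f̂(𝐬) ∏_j (1+|s_j|²)^{r/2} e^{2πi(𝐬,x)}`. -/
noncomputable def WKernel (d : ℕ) (r : ℝ) (f : (Fin d → ℝ) → ℝ) (x : Fin d → ℝ) : ℂ :=
  ∑' s : Fin d → ℤ, fourierCoeffCube d f s * (((∏ j, ((1:ℝ) + (s j : ℝ)^2) ^ (r/2)) : ℝ) : ℂ) *
    Complex.exp ((2 * Real.pi * Complex.I) * (∑ j, (s j : ℂ) * (x j : ℂ)))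

/-- The norm of the Sobolev space `W^r_p` of mixed smoothness `r` on `𝕋^d`. -/
noncomputable def WNorm (d : ℕ) (r : ℝ) (p : ℝ≥0∞) (f : (Fin d → ℝ) → ℝ) : ℝ≥0∞ :=
  eLpNorm (WKernel d r f) p (μcube d)

/-- The Littlewood–Paley square function `(Σ_𝐤 |2^{r|𝐤|₁} q_𝐤(f)|²)^{1/2}`. -/
noncomputable def lpSqFn (d ℓ μ : ℕ) (lam : ℤ → ℝ) (r : ℝ) (f : (Fin d → ℝ) → ℝ)
    (x : Fin d → ℝ) : ℝ :=
  Real.sqrt (∑' k : Fin d → ℕ, ((2:ℝ) ^ (r * ∑ j, (k j : ℝ)) * qmix ℓ μ lam k f x) ^ 2)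

/-- The Smolyak-type sampling operator `R_m(f) = Σ_{|𝐤|₁ ≤ m} q_𝐤(f)`. -/
noncomputable def Rop (ℓ μ : ℕ) (lam : ℤ → ℝ) {d : ℕ} (m : ℕ) (f : (Fin d → ℝ) → ℝ)
    (x : Fin d → ℝ) : ℝ :=
  ∑ k ∈ (Fintype.piFinset fun _ : Fin d => Finset.range (m+1)).filter
      (fun k => ∑ j, k j ≤ m), qmix ℓ μ lam k f x

/-- The unit ball `U^r_p` of `W^r_p` (represented by continuous periodic functions). -/
def unitBallW (d : ℕ) (r p : ℝ) : Set ((Fin d → ℝ) → ℝ) :=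
  {f | Continuous f ∧ PeriodicTd f ∧ WNorm d r (ENNReal.ofReal p) f ≤ 1}

/-- The sampling width `r_n(F, L_q)`. -/
noncomputable def sampWidth (d n : ℕ) (q : ℝ≥0∞) (F : Set ((Fin d → ℝ) → ℝ)) : ℝ≥0∞ :=
  ⨅ (X : Fin n → (Fin d → ℝ)) (Φ : Fin n → (Fin d → ℝ) → ℝ),
    ⨆ f ∈ F, eLpNorm (fun x => f x - ∑ j, f (X j) * Φ j x) q (μcube d)

/-- The Smolyak grid `G^d(m) = {2^{-𝐤}𝐬 : 𝐤 ∈ ℕ^d, |𝐤|₁ = m, 0 ≤ s_j ≤ 2^{k_j}-1}`. -/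
noncomputable def smolyakGrid (d m : ℕ) : Finset (Fin d → ℝ) := by
  classical
  exact ((Fintype.piFinset fun _ : Fin d => Finset.Icc 1 m).filter fun k => ∑ j, k j = m).biUnion
    fun k => (Fintype.piFinset fun j => Finset.range (2 ^ (k j))).image
      fun s => fun j => (s j : ℝ) / 2 ^ (k j)

/-- The Smolyak sampling width `r_n^s(F, L_q)`. -/
noncomputable def smolyakWidth (d n : ℕ) (q : ℝ≥0∞) (F : Set ((Fin d → ℝ) → ℝ)) : ℝ≥0∞ :=
  ⨅ (m : ℕ) (_ : (smolyakGrid d m).card ≤ n) (Φ : (Fin d → ℝ) → (Fin d → ℝ) → ℝ),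
    ⨆ f ∈ F, eLpNorm (fun x => f x - ∑ y ∈ smolyakGrid d m, f y * Φ y x) q (μcube d)

/-- The `a`-th difference in the `j`-th coordinate. -/
noncomputable def deltaCoord {d : ℕ} (a : ℕ) (j : Fin d) (t : ℝ)
    (f : (Fin d → ℝ) → ℝ) (x : Fin d → ℝ) : ℝ :=
  ∑ i ∈ Finset.range (a+1), (-1:ℝ)^(a - i) * (a.choose i : ℝ) *
    f (Function.update x j (x j + (i:ℝ) * t))

/-- The mixed `(a,u)`-th difference `Δ_𝐡^{a,u} = ∏_{i∈u} Δ_{h_i}^a`. -/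
noncomputable def mixedDelta {d : ℕ} (a : ℕ) (u : Finset (Fin d)) (h : Fin d → ℝ)
    (f : (Fin d → ℝ) → ℝ) : (Fin d → ℝ) → ℝ :=
  u.toList.foldr (fun j g => deltaCoord a j (h j) g) f

/-- The mixed modulus of smoothness `ω_a^u(f,𝐭)_p`. -/
noncomputable def besovModulus (d a : ℕ) (u : Finset (Fin d)) (p : ℝ≥0∞)
    (t : Fin d → ℝ) (f : (Fin d → ℝ) → ℝ) : ℝ≥0∞ :=
  ⨆ h : {h : Fin d → ℝ // ∀ i ∈ u, |h i| < t i}, eLpNorm (mixedDelta a u h.1 f) p (μcube d)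

/-- The Besov quasi-seminorm `|f|_{B^{r,u}_{p,θ}}`. -/
noncomputable def besovSemi (d a : ℕ) (p θ : ℝ≥0∞) (r : ℝ) (u : Finset (Fin d))
    (f : (Fin d → ℝ) → ℝ) : ℝ≥0∞ :=
  if θ = ⊤ then
    ⨆ (t : Fin d → ℝ) (_ : t ∈ cube d),
      (∏ i ∈ u, ENNReal.ofReal ((t i) ^ (-r))) * besovModulus d a u p t f
  else
    (∫⁻ t in cube d,
      ((∏ i ∈ u, ENNReal.ofReal ((t i) ^ (-r))) * besovModulus d a u p t f) ^ θ.toReal *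
        (∏ i ∈ u, ENNReal.ofReal (t i)⁻¹)) ^ (1/θ.toReal)

/-- The Besov quasi-norm `‖f‖_{B^r_{p,θ}} = Σ_{u⊂[d]} |f|_{B^{r,u}_{p,θ}}`. -/
noncomputable def besovNorm (d a : ℕ) (p θ : ℝ≥0∞) (r : ℝ)
    (f : (Fin d → ℝ) → ℝ) : ℝ≥0∞ :=
  ∑ u : Finset (Fin d), besovSemi d a p θ r u f

/-- The sequence quasi-norm `(Σ_𝐤 2^{r|𝐤|₁θ} ‖g_𝐤‖_p^θ)^{1/θ}` (sup when `θ = ∞`). -/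
noncomputable def seqNormB (d : ℕ) (p θ : ℝ≥0∞) (r : ℝ)
    (g : (Fin d → ℕ) → (Fin d → ℝ) → ℝ) : ℝ≥0∞ :=
  if θ = ⊤ then
    ⨆ k : Fin d → ℕ, ENNReal.ofReal ((2:ℝ) ^ (r * ∑ j, (k j : ℝ))) * eLpNorm (g k) p (μcube d)
  else
    (∑' k : Fin d → ℕ,
      (ENNReal.ofReal ((2:ℝ) ^ (r * ∑ j, (k j : ℝ))) * eLpNorm (g k) p (μcube d)) ^ θ.toReal) ^
      (1/θ.toReal)

/-- The B-spline sum `q_𝐤 = Σ_{𝐬 ∈ I(𝐤)} c_{𝐤,𝐬} N_{𝐤,𝐬}` with given coefficients. -/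
noncomputable def bsplineSeriesTerm (ℓ : ℕ) {d : ℕ} (c : (Fin d → ℕ) → (Fin d → ℕ) → ℝ)
    (k : Fin d → ℕ) (x : Fin d → ℝ) : ℝ :=
  ∑ s ∈ Fintype.piFinset (fun j => Finset.range (ℓ * 2 ^ (k j))),
    c k s * ∏ j, Nks ℓ (k j) (s j : ℤ) (x j)

section BSpline

theorem bspline_eq_zero {n : ℕ} {x : ℝ} (hx : x < 0 ∨ (n : ℝ) ≤ x) : bspline n x = 0 := by
  induction n generalizing x with
  | zero => rfl
  | succ n ih =>
    rcases n with _ | n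
    · simp only [bspline, ite_eq_right_iff, one_ne_zero, imp_false, not_and, not_lt]
      rcases hx with hx | hx
      · exact fun h => absurd h hx.not_ge
      · simpa using fun _ => hx
    · have hzero : ∀ t ∈ Set.uIcc (0 : ℝ) 1, bspline (n + 1) (x - t) = 0 := by
        intro t ht
        rw [Set.uIcc_of_le zero_le_one, Set.mem_Icc] at ht
        apply ih
        push_cast at hx ⊢
        rcases hx with hx | hx
        · left; linarith [ht.1]
        · right; linarith [ht.2]
      simp only [bspline]
      rw [intervalIntegral.integral_congr hzero]
      simp

theorem intervalIntegrable_bspline (n : ℕ) (a b : ℝ) :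
    IntervalIntegrable (bspline n) volume a b := by
  induction n generalizing a b with
  | zero => exact intervalIntegrable_const (c := (0 : ℝ))
  | succ n ih =>
    rcases n with _ | n
    · have h : bspline 1 = (Set.Ico (0 : ℝ) 1).indicator fun _ => 1 := by
        ext x
        simp [bspline, Set.indicator_apply]
      rw [h, intervalIntegrable_iff]
      exact (integrableOn_const (by simp)).indicator measurableSet_Ico
    · have h : bspline (n + 2) =
          fun x => (∫ t in (0 : ℝ)..x, bspline (n + 1) t) - ∫ t in (0 : ℝ)..(x - 1),
            bspline (n + 1) t := by
        ext x
        simp only [bspline]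
        rw [intervalIntegral.integral_comp_sub_left (fun t => bspline (n + 1) t), sub_zero,
          intervalIntegral.integral_interval_sub_left (ih _ _) (ih _ _)]
      have hc := intervalIntegral.continuous_primitive (μ := volume) ih 0
      rw [h]
      exact (hc.sub (hc.comp (continuous_id.sub continuous_const))).intervalIntegrable _ _

theorem integral_bspline_scaled (n : ℕ) (y : ℝ) :
    ∫ t in (0 : ℝ)..1, bspline (n + 1) (y - 2 * t) =
      (bspline (n + 2) y + bspline (n + 2) (y - 1)) / 2 := by
  have hint (a b : ℝ) : IntervalIntegrable (bspline (n + 1)) volume a b :=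
    intervalIntegrable_bspline _ _ _
  simp only [bspline]
  rw [intervalIntegral.integral_comp_sub_mul (fun t => bspline (n + 1) t) two_ne_zero,
    intervalIntegral.integral_comp_sub_left (fun t => bspline (n + 1) t),
    intervalIntegral.integral_comp_sub_left (fun t => bspline (n + 1) t),
    add_comm (∫ t in (y - 1)..(y - 0), bspline (n + 1) t), sub_zero, sub_zero,
    intervalIntegral.integral_add_adjacent_intervals (hint _ _) (hint _ _), smul_eq_mul]
  ring_nf

/-- The two-scale refinement equation of the cardinal B-spline. -/
theorem bspline_refinement (n : ℕ) (x : ℝ) :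
    bspline (n + 1) x =
      ((2 : ℝ) ^ n)⁻¹ * ∑ j ∈ range (n + 2),
        ((n + 1).choose j : ℝ) * bspline (n + 1) (2 * x - j) := by
  induction n generalizing x with
  | zero =>
    simp only [sum_range_succ, bspline]
    norm_num
    split_ifs <;> grind
  | succ n ih =>
    have hpascal : ∑ j ∈ range (n + 3), ((n + 2).choose j : ℝ) * bspline (n + 2) (2 * x - j) =
        ∑ j ∈ range (n + 2), ((n + 1).choose j : ℝ) *
          (bspline (n + 2) (2 * x - j) + bspline (n + 2) (2 * x - j - 1)) := by
      have hlast : ∑ j ∈ range (n + 2), ((n + 1).choose j : ℝ) * bspline (n + 2) (2 * x - j) =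
          ∑ j ∈ range (n + 2), ((n + 1).choose (j + 1) : ℝ) *
            bspline (n + 2) (2 * x - (j + 1 : ℕ)) + bspline (n + 2) (2 * x) := by
        rw [sum_range_succ' _ (n + 1), sum_range_succ _ (n + 1)]
        simp
      simp only [mul_add, sum_add_distrib]
      rw [hlast, sum_range_succ']
      simp only [Nat.choose_succ_succ (n + 1), Nat.cast_add, add_mul, sum_add_distrib]
      simp only [Nat.succ_eq_add_one, Nat.cast_one, sub_sub, Nat.choose_zero_right,
        Nat.cast_zero, sub_zero, one_mul]
      ring
    have hint (j : ℕ) : IntervalIntegrable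
        (fun t => ((n + 1).choose j : ℝ) * bspline (n + 1) (2 * x - j - 2 * t)) volume 0 1 := by
      have h := (intervalIntegrable_bspline (n + 1) (2 * x - j - 2 * 0)
        (2 * x - j - 2 * 1)).comp_sub_left (2 * x - j)
      have h2 := h.comp_mul_left (c := 2)
      simp only [sub_sub_cancel] at h2
      exact (by simpa using h2 : IntervalIntegrable _ volume 0 1).const_mul _
    calc bspline (n + 2) x
        = ∫ t in (0 : ℝ)..1, ((2 : ℝ) ^ n)⁻¹ * ∑ j ∈ range (n + 2),
            ((n + 1).choose j : ℝ) * bspline (n + 1) (2 * x - j - 2 * t) := by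
          rw [bspline]
          congr 1
          ext t
          rw [ih]
          congr 1
          refine sum_congr rfl fun j _ => ?_
          congr 2
          ring
      _ = _ := by
          rw [intervalIntegral.integral_const_mul,
            intervalIntegral.integral_finsetSum fun j _ => hint j]
          simp only [intervalIntegral.integral_const_mul, integral_bspline_scaled]
          rw [hpascal, mul_sum, mul_sum]
          refine sum_congr rfl fun j _ => ?_
          rw [pow_succ]
          field_simp

theorem hasFiniteSupport_mul_bspline (c : ℤ → ℝ) (n : ℕ) {a : ℝ} (ha : 0 < a) (y : ℝ) :
    (Function.support fun s : ℤ => c s * bspline n (y - a * s)).Finite := by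
  refine (Set.finite_Icc ⌊(y - n) / a⌋ ⌈y / a⌉).subset fun s hs => ?_
  have hs' : ¬ (y - a * s < 0 ∨ (n : ℝ) ≤ y - a * s) := fun h =>
    hs (by simp [bspline_eq_zero h])
  push Not at hs'
  have h1 : (s : ℝ) ≤ y / a := by rw [le_div_iff₀ ha]; linarith [hs'.1]
  have h2 : (y - n) / a ≤ s := by rw [div_le_iff₀ ha]; linarith [hs'.2]
  constructor
  · exact_mod_cast (Int.floor_le _).trans h2
  · exact_mod_cast h1.trans (Int.le_ceil _)

theorem summable_mul_bspline (c : ℤ → ℝ) (n : ℕ) {a : ℝ} (ha : 0 < a) (y : ℝ) :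
    Summable fun s : ℤ => c s * bspline n (y - a * s) :=
  summable_of_hasFiniteSupport (hasFiniteSupport_mul_bspline c n ha y)

end BSpline

section Periodization

/-- Summing a periodic sequence against a summable one by residue classes. -/
theorem tsum_periodic_mul {K : ℕ} (hK : 0 < K) {d F : ℤ → ℝ} (hd : Function.Periodic d K)
    (hF : Summable fun s => d s * F s) :
    ∑' s, d s * F s = ∑ s ∈ range K, d s * ∑' n : ℤ, F (n * K + s) := by
  have : NeZero K := ⟨hK.ne'⟩
  have hd' (n : ℤ) (s : ℤ) : d (n * K + s) = d s := by
    rw [add_comm]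
    simpa using hd.int_mul n s
  let e := (Equiv.prodComm (Fin K) ℤ).trans (Int.divModEquiv K).symm
  have hs : Summable fun p : Fin K × ℤ => d (e p) * F (e p) := hF.comp_injective e.injective
  rw [← e.tsum_eq, hs.tsum_prod, tsum_fintype, ← Fin.sum_univ_eq_sum_range
    fun s => d s * ∑' n : ℤ, F (n * K + s)]
  refine sum_congr rfl fun s _ => ?_
  simp only [e, Equiv.trans_apply, Equiv.prodComm_apply, Prod.swap_prod_mk,
    Int.divModEquiv_symm_apply, hd', tsum_mul_left]

theorem sum_range_two_mul (g : ℕ → ℝ) (K : ℕ) :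
    ∑ s ∈ range (2 * K), g s = ∑ s ∈ range K, g (2 * s) + ∑ s ∈ range K, g (2 * s + 1) := by
  induction K with
  | zero => simp
  | succ K ih =>
    rw [show 2 * (K + 1) = 2 * K + 1 + 1 by ring, sum_range_succ, sum_range_succ, ih,
      sum_range_succ, sum_range_succ]
    ring

variable {ℓ : ℕ}

theorem mul_hstep (hℓ : 0 < ℓ) (k : ℕ) : (ℓ : ℝ) * 2 ^ k * hstep ℓ k = 1 := by
  have : (ℓ : ℝ) ≠ 0 := by positivity
  unfold hstep
  field_simp

theorem hstep_eq_two_mul (ℓ k : ℕ) : hstep ℓ k = 2 * hstep ℓ (k + 1) := by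
  unfold hstep
  rw [pow_succ]
  field_simp

theorem Nks_eq_tsum (hℓ : 0 < ℓ) (k : ℕ) (s : ℤ) (x : ℝ) :
    Nks ℓ k s x = ∑' n : ℤ, bspline ℓ ((ℓ : ℝ) * 2 ^ k * x - s - ℓ * 2 ^ k * n) := by
  unfold Nks Nper
  refine tsum_congr fun n => congrArg _ ?_
  linear_combination (-(s : ℝ)) * mul_hstep hℓ k

theorem tsum_mul_bspline (hℓ : 0 < ℓ) (k : ℕ) {d : ℤ → ℝ}
    (hd : Function.Periodic d ((ℓ * 2 ^ k : ℕ) : ℤ)) (x : ℝ) :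
    ∑' s : ℤ, d s * bspline ℓ ((ℓ : ℝ) * 2 ^ k * x - s) =
      ∑ s ∈ range (ℓ * 2 ^ k), d s * Nks ℓ k s x := by
  have hsum := summable_mul_bspline d ℓ one_pos ((ℓ : ℝ) * 2 ^ k * x)
  simp only [one_mul] at hsum
  rw [tsum_periodic_mul (by positivity) hd hsum]
  refine sum_congr rfl fun s _ => ?_
  rw [Nks_eq_tsum hℓ]
  congr 1
  refine tsum_congr fun n => congrArg _ ?_
  push_cast
  ring

theorem tsum_mul_bspline_two_mul (hℓ : 0 < ℓ) (k : ℕ) {d : ℤ → ℝ}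
    (hd : Function.Periodic d ((ℓ * 2 ^ k : ℕ) : ℤ)) (r : ℤ) (x : ℝ) :
    ∑' s : ℤ, d s * bspline ℓ ((ℓ : ℝ) * 2 ^ (k + 1) * x - r - 2 * s) =
      ∑ s ∈ range (ℓ * 2 ^ k), d s * Nks ℓ (k + 1) (2 * s + r) x := by
  rw [tsum_periodic_mul (by positivity) hd (summable_mul_bspline d ℓ two_pos _)]
  refine sum_congr rfl fun s _ => ?_
  rw [Nks_eq_tsum hℓ]
  congr 1
  refine tsum_congr fun n => congrArg _ ?_
  push_cast
  ring

end Periodization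

section ShiftOp

open LaurentPolynomial

variable (h : ℝ) (f : ℝ → ℝ) (x : ℝ)

theorem shiftOp_add (P Q : LaurentPolynomial ℝ) :
    shiftOp (P + Q) h f x = shiftOp P h f x + shiftOp Q h f x := by
  unfold shiftOp
  rw [AddMonoidAlgebra.coeff_add]
  exact Finsupp.sum_add_index' (by simp) (by intros; ring)

theorem shiftOp_sub (P Q : LaurentPolynomial ℝ) :
    shiftOp (P - Q) h f x = shiftOp P h f x - shiftOp Q h f x := by
  rw [eq_sub_iff_add_eq, ← shiftOp_add, sub_add_cancel]

theorem shiftOp_sum {ι : Type*} (S : Finset ι) (P : ι → LaurentPolynomial ℝ) :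
    shiftOp (∑ i ∈ S, P i) h f x = ∑ i ∈ S, shiftOp (P i) h f x :=
  map_sum (AddMonoidHom.mk' (fun P => shiftOp P h f x) fun P Q => shiftOp_add h f x P Q) P S

theorem shiftOp_C_mul_T (c : ℝ) (n : ℤ) :
    shiftOp (C c * T n) h f x = c * f (x + n * h) := by
  rw [← single_eq_C_mul_T]
  unfold shiftOp
  rw [AddMonoidAlgebra.coeff_single]
  exact Finsupp.sum_single_index (by simp)

theorem shiftOp_mul_C_mul_T (P : LaurentPolynomial ℝ) (c : ℝ) (n : ℤ) :
    shiftOp (P * (C c * T n)) h f x = c * shiftOp P h f (x + n * h) := by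
  induction P using LaurentPolynomial.induction_on' with
  | add p q hp hq => rw [add_mul, shiftOp_add, shiftOp_add, hp, hq, mul_add]
  | C_mul_T m a =>
    rw [mul_mul_mul_comm, ← T_add, ← map_mul, shiftOp_C_mul_T, shiftOp_C_mul_T]
    push_cast
    rw [show x + (m + n : ℝ) * h = x + n * h + m * h by ring]
    ring

theorem shiftOp_C_mul (c : ℝ) (P : LaurentPolynomial ℝ) :
    shiftOp (C c * P) h f x = c * shiftOp P h f x := by
  simpa [mul_comm] using shiftOp_mul_C_mul_T h f x P c 0

variable {f}

theorem shiftOp_periodic (P : LaurentPolynomial ℝ) (hf : Function.Periodic f 1) :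
    Function.Periodic (shiftOp P h f) 1 := fun x =>
  Finsupp.sum_congr fun s _ => by rw [add_right_comm, hf]

end ShiftOp

section Coefficients

variable {ℓ : ℕ} (μ : ℕ) {lam : ℤ → ℝ} (f : ℝ → ℝ)

theorem cast_half (hℓe : Even ℓ) : (((ℓ : ℤ) / 2 : ℤ) : ℝ) = (ℓ : ℝ) / 2 := by
  obtain ⟨m, rfl⟩ := hℓe
  rw [show ((m + m : ℕ) : ℤ) / 2 = m by omega]
  push_cast
  ring

theorem acoef_eq_sum_add (hlam : IsEvenSeq lam) (k : ℕ) (s : ℤ) :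
    acoef ℓ μ lam k s f = ∑ j ∈ Icc (-(μ : ℤ)) μ,
      lam j * f (hstep ℓ k * ((s : ℝ) + j + (ℓ : ℝ) / 2)) := by
  unfold acoef
  refine sum_nbij' (fun j => -j) (fun j => -j) ?_ ?_ (by simp) (by simp) ?_
  · intro j hj; simp only [mem_Icc] at hj ⊢; omega
  · intro j hj; simp only [mem_Icc] at hj ⊢; omega
  · intro j _
    rw [hlam, Int.cast_neg, sub_eq_add_neg]

theorem shiftOp_PLam (hℓe : Even ℓ) (hlam : IsEvenSeq lam) (k : ℕ) (s : ℤ) :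
    shiftOp (PLam ℓ μ lam) (hstep ℓ k) f (s * hstep ℓ k) = acoef ℓ μ lam k s f := by
  rw [acoef_eq_sum_add μ f hlam, PLam, shiftOp_sum]
  refine sum_congr rfl fun j _ => ?_
  rw [shiftOp_C_mul_T, Int.cast_add, cast_half hℓe]
  ring_nf

theorem shiftOp_PLamSq (hℓe : Even ℓ) (hlam : IsEvenSeq lam) (k : ℕ) (s : ℤ) :
    shiftOp (PLamSq ℓ μ lam) (hstep ℓ (k + 1)) f (2 * s * hstep ℓ (k + 1)) =
      acoef ℓ μ lam k s f := by
  rw [acoef_eq_sum_add μ f hlam, PLamSq, shiftOp_sum]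
  refine sum_congr rfl fun j _ => ?_
  rw [shiftOp_C_mul_T, Int.cast_mul, Int.cast_add, cast_half hℓe, hstep_eq_two_mul ℓ k]
  push_cast
  ring_nf

theorem shiftOp_PevenAux (hℓe : Even ℓ) (hlam : IsEvenSeq lam) (k : ℕ) (s : ℤ) :
    shiftOp (PevenAux ℓ μ lam) (hstep ℓ (k + 1)) f (2 * s * hstep ℓ (k + 1)) =
      2 ^ (1 - (ℓ : ℤ)) * ∑ j ∈ range (ℓ / 2 + 1),
        (ℓ.choose (2 * j) : ℝ) * acoef ℓ μ lam k (s - j) f := by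
  rw [PevenAux, mul_assoc, shiftOp_C_mul, mul_sum, shiftOp_sum]
  congr 1
  refine sum_congr rfl fun j _ => ?_
  rw [shiftOp_mul_C_mul_T, ← shiftOp_PLamSq μ f hℓe hlam]
  push_cast
  ring_nf

theorem shiftOp_PoddAux (hℓe : Even ℓ) (hlam : IsEvenSeq lam) (k : ℕ) (s : ℤ) :
    shiftOp (PoddAux ℓ μ lam) (hstep ℓ (k + 1)) f ((2 * s + 1) * hstep ℓ (k + 1)) =
      2 ^ (1 - (ℓ : ℤ)) * ∑ j ∈ range (ℓ / 2),
        (ℓ.choose (2 * j + 1) : ℝ) * acoef ℓ μ lam k (s - j) f := by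
  rw [PoddAux, mul_assoc, shiftOp_C_mul, mul_sum, shiftOp_sum]
  congr 1
  refine sum_congr rfl fun j _ => ?_
  rw [shiftOp_mul_C_mul_T, ← shiftOp_PLamSq μ f hℓe hlam]
  push_cast
  ring_nf

variable {f}

theorem acoef_periodic (hℓ : 0 < ℓ) (hf : Function.Periodic f 1) (k : ℕ) :
    Function.Periodic (fun s => acoef ℓ μ lam k s f) ((ℓ * 2 ^ k : ℕ) : ℤ) := by
  intro s
  refine sum_congr rfl fun j _ => ?_
  rw [← hf (hstep ℓ k * ((s : ℝ) - j + ℓ / 2))]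
  congr 2
  push_cast
  linear_combination mul_hstep hℓ k

theorem Qk_eq_sum (hℓ : 0 < ℓ) (hf : Function.Periodic f 1) (k : ℕ) (x : ℝ) :
    Qk ℓ μ lam k f x = ∑ s ∈ range (ℓ * 2 ^ k), acoef ℓ μ lam k s f * Nks ℓ k s x :=
  tsum_mul_bspline hℓ k (acoef_periodic μ hℓ hf k) x

theorem sum_range_even_odd (hℓe : Even ℓ) (g : ℕ → ℝ) :
    ∑ j ∈ range (ℓ + 1), g j =
      ∑ j ∈ range (ℓ / 2 + 1), g (2 * j) + ∑ j ∈ range (ℓ / 2), g (2 * j + 1) := by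
  obtain ⟨m, rfl⟩ := hℓe
  rw [show (m + m) / 2 = m by omega, sum_range_succ, ← two_mul, sum_range_two_mul,
    sum_range_succ _ m]
  ring

theorem tsum_shift_mul_bspline (a : ℤ → ℝ) (y : ℝ) (j : ℕ) :
    ∑' s : ℤ, a s * bspline ℓ (y - 2 * j - 2 * s) =
      ∑' s : ℤ, a (s - j) * bspline ℓ (y - 2 * s) := by
  rw [← (Equiv.subRight (j : ℤ)).tsum_eq]
  refine tsum_congr fun s => ?_
  simp only [Equiv.subRight_apply]
  push_cast
  ring_nf

theorem tsum_mul_bspline_refinement (hℓ : 0 < ℓ) (hℓe : Even ℓ) (a : ℤ → ℝ) (y : ℝ) :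
    ∑' s : ℤ, a s * bspline ℓ (y - s) =
      ∑' s : ℤ, (2 ^ (1 - (ℓ : ℤ)) * ∑ j ∈ range (ℓ / 2 + 1),
        (ℓ.choose (2 * j) : ℝ) * a (s - j)) * bspline ℓ (2 * y - 2 * s) +
      ∑' s : ℤ, (2 ^ (1 - (ℓ : ℤ)) * ∑ j ∈ range (ℓ / 2),
        (ℓ.choose (2 * j + 1) : ℝ) * a (s - j)) * bspline ℓ (2 * y - 1 - 2 * s) := by
  have hrefine (x : ℝ) : bspline ℓ x = 2 ^ (1 - (ℓ : ℤ)) * ∑ j ∈ range (ℓ + 1),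
      (ℓ.choose j : ℝ) * bspline ℓ (2 * x - j) := by
    obtain ⟨n, rfl⟩ := Nat.exists_eq_add_one.mpr hℓ
    rw [bspline_refinement]
    congr 1
    rw [show (1 - ((n + 1 : ℕ) : ℤ)) = -(n : ℤ) by push_cast; ring, zpow_neg, zpow_natCast]
  have hpull (c : ℕ → ℝ) (N : ℕ) (z : ℝ) :
      ∑' s : ℤ, (2 ^ (1 - (ℓ : ℤ)) * ∑ j ∈ range N, c j * a (s - j)) * bspline ℓ (z - 2 * s) =
        2 ^ (1 - (ℓ : ℤ)) * ∑ j ∈ range N,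
          c j * ∑' s : ℤ, a s * bspline ℓ (z - 2 * j - 2 * s) := by
    simp only [tsum_shift_mul_bspline, ← tsum_mul_left]
    rw [← Summable.tsum_finsetSum, ← tsum_mul_left]
    · refine tsum_congr fun s => ?_
      rw [mul_assoc, sum_mul]
      simp only [mul_assoc]
    · exact fun j _ => (summable_mul_bspline (fun s => a (s - j)) ℓ two_pos z).mul_left _
  rw [hpull (fun j => (ℓ.choose (2 * j) : ℝ)), hpull (fun j => (ℓ.choose (2 * j + 1) : ℝ)),
    ← mul_add]
  have hcomb : ∑ j ∈ range (ℓ + 1), (ℓ.choose j : ℝ) *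
      ∑' s : ℤ, a s * bspline ℓ (2 * y - j - 2 * s) = _ := sum_range_even_odd hℓe _
  simp only [Nat.cast_add, Nat.cast_mul, Nat.cast_ofNat, Nat.cast_one] at hcomb
  simp only [sub_sub, add_comm (1 : ℝ)] at hcomb ⊢
  simp only [add_right_comm _ (1 : ℝ)] at hcomb ⊢
  rw [← hcomb]
  simp only [← tsum_mul_left, ← sub_sub]
  rw [← Summable.tsum_finsetSum, ← tsum_mul_left]
  · refine tsum_congr fun s => ?_
    rw [hrefine, mul_left_comm, mul_sum]
    congr 1
    refine sum_congr rfl fun j _ => ?_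
    rw [mul_left_comm]
    ring_nf
  · exact fun j _ => (summable_mul_bspline a ℓ two_pos (2 * y - j)).mul_left _

theorem Qk_eq_sum_succ (hℓ : 0 < ℓ) (hℓe : Even ℓ) (hlam : IsEvenSeq lam)
    (hf : Function.Periodic f 1) (k : ℕ) (x : ℝ) :
    Qk ℓ μ lam k f x =
      ∑ s ∈ range (ℓ * 2 ^ k), shiftOp (PevenAux ℓ μ lam) (hstep ℓ (k + 1)) f
        (2 * s * hstep ℓ (k + 1)) * Nks ℓ (k + 1) (2 * s) x +
      ∑ s ∈ range (ℓ * 2 ^ k), shiftOp (PoddAux ℓ μ lam) (hstep ℓ (k + 1)) f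
        ((2 * s + 1) * hstep ℓ (k + 1)) * Nks ℓ (k + 1) (2 * s + 1) x := by
  have hper (P : LaurentPolynomial ℝ) (r : ℝ) : Function.Periodic
      (fun s : ℤ => shiftOp P (hstep ℓ (k + 1)) f ((2 * s + r) * hstep ℓ (k + 1)))
      ((ℓ * 2 ^ k : ℕ) : ℤ) := by
    intro s
    simp only
    rw [← shiftOp_periodic _ P hf ((2 * s + r) * hstep ℓ (k + 1))]
    congr 1
    have := mul_hstep hℓ (k + 1)
    push_cast
    linear_combination this
  have heven := tsum_mul_bspline_two_mul hℓ k (hper (PevenAux ℓ μ lam) 0) 0 x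
  have hodd := tsum_mul_bspline_two_mul hℓ k (hper (PoddAux ℓ μ lam) 1) 1 x
  simp only [add_zero, Int.cast_zero, sub_zero, Int.cast_natCast, Int.cast_one] at heven hodd
  rw [← heven, ← hodd, Qk, tsum_mul_bspline_refinement hℓ hℓe]
  simp only [shiftOp_PevenAux μ f hℓe hlam, shiftOp_PoddAux μ f hℓe hlam]
  rw [show 2 * ((ℓ : ℝ) * 2 ^ k * x) = ℓ * 2 ^ (k + 1) * x by ring]

end Coefficients

/-- for continuous 1-periodic `f`,
`Q_0(f) = Σ_{s∈I(0)} T_{h^{(0)}}^{[P_Λ]}(f)(s h^{(0)}) N_{0,s}` and for `k ≥ 1`,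
`Q_k(f) - Q_{k-1}(f)` splits into even and odd parts generated by `P_even` and `P_odd`. -/
theorem Qk_even_odd_decomposition (ℓ μ : ℕ) (hℓe : Even ℓ) (hℓ : 0 < ℓ) (hμ : ℓ/2 - 1 ≤ μ)
    (lam : ℤ → ℝ) (hlam : IsEvenSeq lam)
    (f : ℝ → ℝ) (hfc : Continuous f) (hfp : Function.Periodic f 1) :
    (∀ x : ℝ, Qk ℓ μ lam 0 f x
        = ∑ s ∈ Finset.range ℓ,
            shiftOp (PLam ℓ μ lam) (hstep ℓ 0) f ((s:ℝ) * hstep ℓ 0) * Nks ℓ 0 (s:ℤ) x) ∧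
    ∀ k : ℕ, 1 ≤ k → ∀ x : ℝ,
      Qk ℓ μ lam k f x - Qk ℓ μ lam (k-1) f x
        = (∑ s ∈ Finset.range (ℓ * 2^(k-1)),
            shiftOp (Peven ℓ μ lam) (hstep ℓ k) f ((2*(s:ℝ)) * hstep ℓ k)
              * Nks ℓ k (2*(s:ℤ)) x)
        + (∑ s ∈ Finset.range (ℓ * 2^(k-1)),
            shiftOp (Podd ℓ μ lam) (hstep ℓ k) f ((2*(s:ℝ)+1) * hstep ℓ k)
              * Nks ℓ k (2*(s:ℤ)+1) x) := by
  have hPLam (k : ℕ) (s : ℤ) := shiftOp_PLam μ f hℓe hlam k s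
  refine ⟨fun x => ?_, fun k hk x => ?_⟩
  · rw [Qk_eq_sum μ hℓ hfp, pow_zero, mul_one]
    refine sum_congr rfl fun s _ => ?_
    rw [← hPLam, Int.cast_natCast]
  · obtain ⟨k, rfl⟩ := Nat.exists_eq_add_one.mpr hk
    rw [Nat.add_sub_cancel, Qk_eq_sum μ hℓ hfp, Qk_eq_sum_succ μ hℓ hℓe hlam hfp,
      show ℓ * 2 ^ (k + 1) = 2 * (ℓ * 2 ^ k) by ring, sum_range_two_mul, add_sub_add_comm,
      ← sum_sub_distrib, ← sum_sub_distrib]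
    congr 1 <;> refine sum_congr rfl fun s _ => ?_
    · rw [Peven, shiftOp_sub, sub_mul, ← hPLam]
      push_cast
      rfl
    · rw [Podd, shiftOp_sub, sub_mul, ← hPLam]
      push_cast
      rfl
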